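/- arXiv:0806.1125 — 5 statements merged into one kernel-verified Lean document; each statement's English description precedes it below -/
import Mathlib

section
/- Let 1 ≤ i ≤ n and let V be a positive word whose letters lie among a_1, …, a_i. Then in the braid group B_{n+1} one has Δ_i^{−1} V Δ_i = V^{Δ_i} and Δ_i V Δ_i^{−1} = V^{Δ_i}; that is, conjugation by Δ_i^{±1} realizes the index-reversing substitution a_j ↦ a_{i−j+1} on positive words in a_1, …, a_i. -/
/-- Defining relations of the braid monoid/group on `n` strands' generators `Fin n`
(generator `i : Fin n` represents the Artin generator `a_{i+1}`):
braid relations `a_{i+1} a_i a_{i+1} = a_i a_{i+1} a_i` and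
commutation `a_k a_s = a_s a_k` for `k - s ≥ 2`. -/
def braidRels (n : ℕ) : FreeMonoid (Fin n) → FreeMonoid (Fin n) → Prop := fun x y =>
  (∃ i j : Fin n, (i : ℕ) + 1 = j ∧
      x = .of j * .of i * .of j ∧ y = .of i * .of j * .of i) ∨
  (∃ i j : Fin n, (i : ℕ) + 2 ≤ j ∧
      x = .of j * .of i ∧ y = .of i * .of j)

/-- The positive braid monoid `B⁺_{n+1}`. -/
def BraidMonoid (n : ℕ) : Type := PresentedMonoid (braidRels n)

instance (n : ℕ) : Monoid (BraidMonoid n) :=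
  inferInstanceAs (Monoid (PresentedMonoid (braidRels n)))

/-- Relators of the braid group `B_{n+1}` on generators `Fin n`. -/
def braidRelators (n : ℕ) : Set (FreeGroup (Fin n)) :=
  {r | (∃ i j : Fin n, (i : ℕ) + 1 = j ∧
          r = .of j * .of i * .of j * (.of i * .of j * .of i)⁻¹) ∨
       (∃ i j : Fin n, (i : ℕ) + 2 ≤ j ∧
          r = .of j * .of i * (.of i * .of j)⁻¹)}

/-- The braid group `B_{n+1}`. -/
def BraidGroup (n : ℕ) : Type := PresentedGroup (braidRelators n)

instance (n : ℕ) : Group (BraidGroup n) :=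
  inferInstanceAs (Group (PresentedGroup (braidRelators n)))

namespace Braid

/-- The Artin generator `a_i` (`1 ≤ i ≤ n`) of the positive braid monoid;
junk value `1` outside this range. -/
def a (n i : ℕ) : BraidMonoid n :=
  if h : 1 ≤ i ∧ i ≤ n then PresentedMonoid.of (braidRels n) ⟨i - 1, by omega⟩ else 1

/-- The Artin generator `a_i` (`1 ≤ i ≤ n`) of the braid group; junk value `1` otherwise. -/
def b (n i : ℕ) : BraidGroup n :=
  if h : 1 ≤ i ∧ i ≤ n then PresentedGroup.of (rels := braidRelators n) ⟨i - 1, by omega⟩ else 1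

/-- The element of `B⁺_{n+1}` given by a positive word, i.e. a list of indices of
Artin generators. -/
def w (n : ℕ) (L : List ℕ) : BraidMonoid n := (L.map (a n)).prod

/-- The element of `B_{n+1}` given by a positive word. -/
def wG (n : ℕ) (L : List ℕ) : BraidGroup n := (L.map (b n)).prod

/-- `Λ_i = a_i a_{i-1} ⋯ a_1`. -/
def Lam (n i : ℕ) : BraidMonoid n := ((List.range i).reverse.map (fun m => a n (m + 1))).prod

/-- `Λ_i^{(−)} = a_i a_{i-1} ⋯ a_2`  (`Λ_1^{(−)} = 1`). -/
def LamM (n i : ℕ) : BraidMonoid n :=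
  ((List.range (i - 1)).reverse.map (fun m => a n (m + 2))).prod

/-- `Λ_i^{(−−)} = a_i a_{i-1} ⋯ a_3`  (`Λ_2^{(−−)} = 1`). -/
def LamMM (n i : ℕ) : BraidMonoid n :=
  ((List.range (i - 2)).reverse.map (fun m => a n (m + 3))).prod

/-- `Δ_i = Λ_1 Λ_2 ⋯ Λ_i`. -/
def DeltaI (n i : ℕ) : BraidMonoid n := ((List.range i).map (fun m => Lam n (m + 1))).prod

/-- The Garside element `Δ = Λ_1 Λ_2 ⋯ Λ_n`. -/
def Delta (n : ℕ) : BraidMonoid n := DeltaI n n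

/-- `Λ_i` in the braid group. -/
def LamG (n i : ℕ) : BraidGroup n := ((List.range i).reverse.map (fun m => b n (m + 1))).prod

/-- `Δ_i = Λ_1 Λ_2 ⋯ Λ_i` in the braid group. -/
def DeltaIG (n i : ℕ) : BraidGroup n := ((List.range i).map (fun m => LamG n (m + 1))).prod

/-- The descending run `a_{ij} = a_i a_{i-1} ⋯ a_j` (`j ≤ i`), with `a_{i,i+1} = 1`. -/
def run (n i j : ℕ) : BraidMonoid n :=
  ((List.range (i + 1 - j)).reverse.map (fun m => a n (m + j))).prod

end Braid

namespace Braid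

theorem b_of_mem (n i : ℕ) (h : 1 ≤ i ∧ i ≤ n) :
    b n i = PresentedGroup.mk (braidRelators n) (.of ⟨i - 1, by omega⟩) :=
  dif_pos h

theorem b_of_notMem (n i : ℕ) (h : ¬(1 ≤ i ∧ i ≤ n)) : b n i = 1 :=
  dif_neg h

theorem b_braid (n i : ℕ) (h1 : 1 ≤ i) (h2 : i + 1 ≤ n) :
    b n (i + 1) * b n i * b n (i + 1) = b n i * b n (i + 1) * b n i := by
  have hr : (.of ⟨i, by omega⟩ * .of ⟨i - 1, by omega⟩ * .of ⟨i, by omega⟩ *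
      (.of ⟨i - 1, by omega⟩ * .of ⟨i, by omega⟩ * .of ⟨i - 1, by omega⟩)⁻¹ :
        FreeGroup (Fin n)) ∈ braidRelators n :=
    Or.inl ⟨⟨i - 1, by omega⟩, ⟨i, by omega⟩, by simp only; omega, rfl⟩
  have := PresentedGroup.mk_eq_mk_of_mul_inv_mem hr
  rw [b_of_mem n i ⟨h1, by omega⟩, b_of_mem n (i + 1) ⟨by omega, h2⟩]
  exact this

theorem commute_b (n i j : ℕ) (h : i + 2 ≤ j) : Commute (b n j) (b n i) := by
  by_cases hi : 1 ≤ i ∧ i ≤ n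
  swap
  · rw [b_of_notMem n i hi]
    exact Commute.one_right _
  by_cases hj : 1 ≤ j ∧ j ≤ n
  swap
  · rw [b_of_notMem n j hj]
    exact Commute.one_left _
  have hr : (.of ⟨j - 1, by omega⟩ * .of ⟨i - 1, by omega⟩ *
      (.of ⟨i - 1, by omega⟩ * .of ⟨j - 1, by omega⟩)⁻¹ :
        FreeGroup (Fin n)) ∈ braidRelators n :=
    Or.inr ⟨⟨i - 1, by omega⟩, ⟨j - 1, by omega⟩, by simp only; omega, rfl⟩
  have := PresentedGroup.mk_eq_mk_of_mul_inv_mem hr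
  rw [b_of_mem n i hi, b_of_mem n j hj]
  exact this

theorem LamG_zero (n : ℕ) : LamG n 0 = 1 := rfl

theorem LamG_succ (n i : ℕ) : LamG n (i + 1) = b n (i + 1) * LamG n i := by
  simp [LamG, List.range_succ]

theorem DeltaIG_zero (n : ℕ) : DeltaIG n 0 = 1 := rfl

theorem DeltaIG_succ (n i : ℕ) : DeltaIG n (i + 1) = DeltaIG n i * LamG n (i + 1) := by
  simp [DeltaIG, List.range_succ]

theorem commute_b_LamG (n i j : ℕ) (h : i + 2 ≤ j) : Commute (b n j) (LamG n i) := by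
  induction i with
  | zero => exact Commute.one_right _
  | succ i ih =>
    rw [LamG_succ]
    exact (commute_b n _ _ h).mul_right (ih (by omega))

theorem commute_b_DeltaIG (n i j : ℕ) (h : i + 2 ≤ j) : Commute (b n j) (DeltaIG n i) := by
  induction i with
  | zero => exact Commute.one_right _
  | succ i ih =>
    rw [DeltaIG_succ]
    exact (ih (by omega)).mul_right (commute_b_LamG n _ _ h)

/-- Moving a generator across `Λ_m` from right to left lowers its index by one. -/
theorem LamG_mul_b (n k m : ℕ) (hk : 1 ≤ k) (hkm : k + 1 ≤ m) (hm : m ≤ n) :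
    LamG n m * b n (k + 1) = b n k * LamG n m := by
  induction m, hkm using Nat.le_induction with
  | base =>
    obtain ⟨q, rfl⟩ := Nat.exists_eq_add_of_le' hk
    have hc := (commute_b_LamG n q (q + 1 + 1) le_rfl).eq
    have hb := b_braid n (q + 1) hk hm
    rw [LamG_succ, LamG_succ, mul_assoc, mul_assoc, ← hc, ← mul_assoc, ← mul_assoc, hb]
    simp only [mul_assoc]
  | succ m hkm ih =>
    rw [LamG_succ, mul_assoc, ih (by omega), ← mul_assoc, (commute_b n k (m + 1) (by omega)).eq,
      mul_assoc]

theorem LamG_mul_LamG_succ (n k m : ℕ) (hkm : k + 1 ≤ m) (hm : m ≤ n) :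
    LamG n m * LamG n (k + 1) = LamG n k * LamG n m * b n 1 := by
  induction k with
  | zero => simp [LamG_succ, LamG_zero]
  | succ k ih =>
    rw [LamG_succ n (k + 1), ← mul_assoc, LamG_mul_b n (k + 1) m (by omega) hkm hm, mul_assoc,
      ih (by omega), LamG_succ n k]
    simp only [mul_assoc]

theorem b_mul_DeltaIG (n i j : ℕ) (hi : i ≤ n) (hj1 : 1 ≤ j) (hj2 : j ≤ i) :
    b n j * DeltaIG n i = DeltaIG n i * b n (i - j + 1) := by
  induction i with
  | zero => omega
  | succ i ih =>
    rcases Nat.lt_or_ge i j with hij | hij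
    · obtain rfl : j = i + 1 := by omega
      rw [Nat.sub_self, zero_add]
      cases i with
      | zero => simp [DeltaIG_succ, DeltaIG_zero, LamG_succ, LamG_zero]
      | succ i =>
        have h := LamG_mul_LamG_succ n (i + 1) (i + 1 + 1) le_rfl hi
        rw [DeltaIG_succ, DeltaIG_succ, ← mul_assoc, ← mul_assoc,
          (commute_b_DeltaIG n i (i + 1 + 1) le_rfl).eq, mul_assoc (DeltaIG n i) (b n _),
          ← LamG_succ, mul_assoc, h]
        simp only [mul_assoc]
    · rw [DeltaIG_succ, ← mul_assoc, ih (by omega) hij, mul_assoc,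
        ← LamG_mul_b n (i - j + 1) (i + 1) (by omega) (by omega) hi, ← mul_assoc,
        Nat.sub_add_comm hij]

theorem wG_mul_DeltaIG (n i : ℕ) (hi : i ≤ n) (V : List ℕ) (hV : ∀ m ∈ V, 1 ≤ m ∧ m ≤ i) :
    wG n V * DeltaIG n i = DeltaIG n i * wG n (V.map (fun m => i - m + 1)) := by
  induction V with
  | nil => simp [wG]
  | cons m V ih =>
    obtain ⟨hm, hV'⟩ := List.forall_mem_cons.1 hV
    have h := ih hV'
    simp only [wG, List.map_cons, List.prod_cons] at h ⊢
    rw [mul_assoc, h, ← mul_assoc, b_mul_DeltaIG n i m hi hm.1 hm.2, mul_assoc]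

end Braid

/-- For `1 ≤ i ≤ n` and a positive word `V` in the letters `a_1, …, a_i`,
conjugation by `Δ_i^{±1}` in the braid group realizes the index-reversing substitution
`a_j ↦ a_{i−j+1}`: `Δ_i⁻¹ V Δ_i = V^{Δ_i}` and `Δ_i V Δ_i⁻¹ = V^{Δ_i}`. -/
theorem conj_DeltaI_eq_rev (n i : ℕ) (hi1 : 1 ≤ i) (hi2 : i ≤ n) (V : List ℕ)
    (hV : ∀ m ∈ V, 1 ≤ m ∧ m ≤ i) :
    (Braid.DeltaIG n i)⁻¹ * Braid.wG n V * Braid.DeltaIG n i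
        = Braid.wG n (V.map (fun m => i - m + 1)) ∧
    Braid.DeltaIG n i * Braid.wG n V * (Braid.DeltaIG n i)⁻¹
        = Braid.wG n (V.map (fun m => i - m + 1)) := by
  have key := Braid.wG_mul_DeltaIG n i hi2
  refine ⟨by rw [mul_assoc, key V hV, inv_mul_cancel_left], ?_⟩
  have h := key (V.map (fun m => i - m + 1)) fun m hm => by
    obtain ⟨k, hk, rfl⟩ := List.mem_map.1 hm
    have := hV k hk
    omega
  have hrev : (V.map (fun m => i - m + 1)).map (fun m => i - m + 1) = V := by
    rw [List.map_map]
    refine (List.map_congr_left fun m hm => ?_).trans (List.map_id V)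
    have := hV m hm
    simp only [Function.comp_apply, id_eq]
    omega
  rw [hrev] at h
  rw [← h, mul_inv_cancel_right]
end

section
/- Let 1 ≤ j ≤ i ≤ n−1 and let W be a positive word whose letters lie among a_j, …, a_i. Then W a_{i+1,j} = a_{i+1,j} W' in the positive braid monoid B⁺_{n+1}. -/
namespace Braid

theorem a_eq_of {n i : ℕ} (h : 1 ≤ i ∧ i ≤ n) :
    a n i = (PresentedMonoid.of (braidRels n) ⟨i - 1, by omega⟩ : PresentedMonoid (braidRels n)) :=
  dif_pos h

theorem a_comm {n s k : ℕ} (h : s + 2 ≤ k) : Commute (a n k) (a n s) := by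
  by_cases hk : 1 ≤ k ∧ k ≤ n
  · by_cases hs : 1 ≤ s ∧ s ≤ n
    · rw [a_eq_of hk, a_eq_of hs]
      exact (conGen (braidRels n)).eq.2 (.of _ _ (Or.inr
        ⟨⟨s - 1, by omega⟩, ⟨k - 1, by omega⟩, show s - 1 + 2 ≤ k - 1 by omega, rfl, rfl⟩))
    · have e : a n s = 1 := dif_neg hs
      exact e ▸ Commute.one_right _
  · have e : a n k = 1 := dif_neg hk
    exact e ▸ Commute.one_left _

theorem a_braid {n i : ℕ} (hi : 1 ≤ i) (hn : i + 1 ≤ n) :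
    a n (i + 1) * a n i * a n (i + 1) = a n i * a n (i + 1) * a n i := by
  rw [a_eq_of (by omega : 1 ≤ i ∧ i ≤ n), a_eq_of (by omega : 1 ≤ i + 1 ∧ i + 1 ≤ n)]
  exact (conGen (braidRels n)).eq.2 (.of _ _ (Or.inl
    ⟨⟨i - 1, by omega⟩, ⟨i + 1 - 1, by omega⟩, show i - 1 + 1 = i + 1 - 1 by omega, rfl, rfl⟩))

theorem run_succ {n i j : ℕ} (h : j ≤ i + 1) : run n (i + 1) j = a n (i + 1) * run n i j := by
  rw [run, run, show i + 1 + 1 - j = (i + 1 - j) + 1 by omega, List.range_succ]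
  simp [Nat.sub_add_cancel h]

theorem a_commute_run {n k s j : ℕ} (h : k + 2 ≤ s) : Commute (a n s) (run n k j) := by
  refine Commute.list_prod_right _ _ fun x hx => ?_
  simp only [List.mem_map, List.mem_reverse, List.mem_range] at hx
  obtain ⟨m, hm, rfl⟩ := hx
  exact a_comm (by omega)

/-- Moving a single generator through a descending run raises its index by one. -/
theorem a_mul_run {n i j m : ℕ} (hj : 1 ≤ j) (hjm : j ≤ m) (hmi : m ≤ i) (hi : i + 1 ≤ n) :
    a n m * run n (i + 1) j = run n (i + 1) j * a n (m + 1) := by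
  induction i, hmi using Nat.le_induction with
  | base =>
    obtain ⟨p, rfl⟩ : ∃ p, m = p + 1 := ⟨m - 1, by omega⟩
    rw [run_succ (by omega), run_succ hjm, ← mul_assoc, ← mul_assoc,
      ← a_braid (by omega) hi, mul_assoc _ _ (run n p j),
      (a_commute_run (n := n) (s := p + 1 + 1) (j := j) le_rfl).eq]
    simp only [mul_assoc]
  | succ k hmk ih =>
    rw [run_succ (i := k + 1) (by omega), ← mul_assoc,
      ← (a_comm (n := n) (s := m) (k := k + 1 + 1) (by omega)).eq, mul_assoc, ih (by omega),
      mul_assoc]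

end Braid

/-- For `1 ≤ j ≤ i ≤ n−1` and a positive word `W` in the letters `a_j, …, a_i`,
one has `W a_{i+1,j} = a_{i+1,j} W'` in the positive braid monoid `B⁺_{n+1}`. -/
theorem word_mul_run (n i j : ℕ) (hj : 1 ≤ j) (hji : j ≤ i) (hi : i ≤ n - 1)
    (W : List ℕ) (hW : ∀ m ∈ W, j ≤ m ∧ m ≤ i) :
    Braid.w n W * Braid.run n (i + 1) j
      = Braid.run n (i + 1) j * Braid.w n (W.map (· + 1)) := by
  induction W with
  | nil => simp [Braid.w]
  | cons m W ih =>
    obtain ⟨⟨hjm, hmi⟩, hW⟩ := List.forall_mem_cons.1 hW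
    have ih := ih hW
    simp only [Braid.w, List.map_cons, List.prod_cons] at ih ⊢
    rw [mul_assoc, ih, ← mul_assoc, Braid.a_mul_run hj hjm hmi (by omega), mul_assoc]
end

section
/- Let 2 ≤ i ≤ n and let V be a positive word whose letters lie among a_1, …, a_{i−1}. Then V Λ_i = Λ_i V' in the positive braid monoid B⁺_{n+1}. -/
namespace Braid

theorem a_eq (n i : ℕ) (h : 1 ≤ i ∧ i ≤ n) :
    a n i = (PresentedMonoid.of (braidRels n) ⟨i - 1, by omega⟩ : PresentedMonoid (braidRels n)) :=
  dif_pos h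

theorem a_braid_s4 (n k : ℕ) (h1 : 1 ≤ k) (h2 : k + 1 ≤ n) :
    a n k * a n (k + 1) * a n k = a n (k + 1) * a n k * a n (k + 1) := by
  rw [a_eq n k ⟨h1, by omega⟩, a_eq n (k + 1) ⟨by omega, h2⟩]
  refine Eq.symm (PresentedMonoid.mk_eq_mk_of_rel (rels := braidRels n) (Or.inl
    ⟨⟨k - 1, by omega⟩, ⟨k + 1 - 1, by omega⟩, ?_, rfl, rfl⟩))
  exact Nat.sub_add_cancel h1

theorem a_comm_s4 (n s k : ℕ) (h1 : 1 ≤ s) (h2 : s + 2 ≤ k) (h3 : k ≤ n) :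
    a n k * a n s = a n s * a n k := by
  rw [a_eq n k ⟨by omega, h3⟩, a_eq n s ⟨h1, by omega⟩]
  refine PresentedMonoid.mk_eq_mk_of_rel (rels := braidRels n) (Or.inr
    ⟨⟨s - 1, by omega⟩, ⟨k - 1, by omega⟩, ?_, rfl, rfl⟩)
  change s - 1 + 2 ≤ k - 1
  omega

theorem Lam_succ (n i : ℕ) : Lam n (i + 1) = a n (i + 1) * Lam n i := by
  simp [Lam, List.range_succ]

theorem a_mul_Lam_of_add_two_le (n i k : ℕ) (h : i + 2 ≤ k) (hk : k ≤ n) :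
    a n k * Lam n i = Lam n i * a n k := by
  induction i with
  | zero => simp [Lam]
  | succ i ih =>
    rw [Lam_succ, ← mul_assoc, a_comm_s4 n (i + 1) k (by omega) h hk, mul_assoc,
      ih (by omega), mul_assoc]

theorem a_mul_Lam (n i m : ℕ) (hi : i ≤ n) (h1 : 1 ≤ m) (hm : m < i) :
    a n m * Lam n i = Lam n i * a n (m + 1) := by
  induction i with
  | zero => omega
  | succ i ih =>
    rcases Nat.lt_succ_iff_lt_or_eq.mp hm with h | rfl
    · rw [Lam_succ, ← mul_assoc, ← a_comm_s4 n m (i + 1) h1 (by omega) hi, mul_assoc,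
        ih (by omega) h, mul_assoc]
    · obtain ⟨j, rfl⟩ : ∃ j, m = j + 1 := ⟨m - 1, by omega⟩
      rw [Lam_succ, Lam_succ, ← mul_assoc, ← mul_assoc, a_braid_s4 n (j + 1) h1 hi,
        mul_assoc, a_mul_Lam_of_add_two_le n j (j + 1 + 1) le_rfl hi]
      simp only [mul_assoc]

end Braid

/-- For `2 ≤ i ≤ n` and a positive word `V` in the letters `a_1, …, a_{i−1}`,
one has `V Λ_i = Λ_i V'` in the positive braid monoid `B⁺_{n+1}`. -/
theorem word_mul_Lam (n i : ℕ) (hi1 : 2 ≤ i) (hi2 : i ≤ n) (V : List ℕ)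
    (hV : ∀ m ∈ V, 1 ≤ m ∧ m ≤ i - 1) :
    Braid.w n V * Braid.Lam n i = Braid.Lam n i * Braid.w n (V.map (· + 1)) := by
  induction V with
  | nil => simp [Braid.w]
  | cons m V ih =>
    have hm := hV m List.mem_cons_self
    have ih' := ih fun k hk => hV k (List.mem_cons_of_mem m hk)
    simp only [Braid.w, List.map_cons, List.prod_cons] at ih' ⊢
    rw [mul_assoc, ih', ← mul_assoc, Braid.a_mul_Lam n i m hi2 hm.1 (by omega), mul_assoc]
end

section
/- Let 2 ≤ i ≤ n and let W be a positive word whose letters lie among a_1, …, a_{i−1}. Then in the positive braid monoid B⁺_{n+1} one has W' Λ_2^{(−)} Λ_3^{(−)} ⋯ Λ_i^{(−)} = Λ_2^{(−)} Λ_3^{(−)} ⋯ Λ_i^{(−)} W^{Δ_i}. -/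
namespace Braid

section Monoid

variable {M : Type*} [Monoid M]

/-- The descending product `d (r - 1) * ⋯ * d 1 * d 0`. -/
def descProd (d : ℕ → M) : ℕ → M
  | 0 => 1
  | r + 1 => d r * descProd d r

/-- The product `descProd d 1 * descProd d 2 * ⋯ * descProd d k`. -/
def fundProd (d : ℕ → M) : ℕ → M
  | 0 => 1
  | k + 1 => fundProd d k * descProd d (k + 1)

theorem descProd_eq_prod (d : ℕ → M) (r : ℕ) :
    descProd d r = ((List.range r).reverse.map d).prod := by
  induction r with
  | zero => rfl
  | succ r ih => simp [descProd, List.range_succ, ih]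

theorem fundProd_eq_prod (d : ℕ → M) (k : ℕ) :
    fundProd d k = ((List.range k).map fun m => descProd d (m + 1)).prod := by
  induction k with
  | zero => rfl
  | succ k ih => simp [fundProd, List.range_succ, ih]

theorem descProd_succ' (d : ℕ → M) (r : ℕ) :
    descProd d (r + 1) = descProd (fun j => d (j + 1)) r * d 0 := by
  induction r with
  | zero => simp [descProd]
  | succ r ih => rw [descProd, ih, descProd, mul_assoc]

/-- The first `N` terms of the sequence `d` satisfy the braid relations. -/
structure IsBraidSeq (d : ℕ → M) (N : ℕ) : Prop where
  braid : ∀ j, j + 1 < N → d (j + 1) * d j * d (j + 1) = d j * d (j + 1) * d j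
  comm : ∀ s k, s + 2 ≤ k → k < N → Commute (d k) (d s)

namespace IsBraidSeq

variable {d : ℕ → M} {N : ℕ}

theorem commute_descProd (hd : IsBraidSeq d N) {r k : ℕ} (hrk : r < k) (hk : k < N) :
    Commute (d k) (descProd d r) := by
  induction r with
  | zero => exact Commute.one_right _
  | succ r ih => exact (hd.comm r k (by omega) hk).mul_right (ih (by omega))

theorem commute_fundProd (hd : IsBraidSeq d N) {r k : ℕ} (hrk : r < k) (hk : k < N) :
    Commute (d k) (fundProd d r) := by
  induction r with
  | zero => exact Commute.one_right _
  | succ r ih => exact (ih (by omega)).mul_right (hd.commute_descProd hrk hk)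

theorem semiconjBy_descProd (hd : IsBraidSeq d N) {r j : ℕ} (hj : j + 1 < r) (hr : r ≤ N) :
    SemiconjBy (descProd d r) (d (j + 1)) (d j) := by
  induction r with
  | zero => omega
  | succ r ih =>
    rcases Nat.lt_or_ge (j + 1) r with h | h
    · exact SemiconjBy.mul_left (hd.comm j r (by omega) (by omega)) (ih h (by omega))
    · obtain rfl : r = j + 1 := by omega
      have hc := hd.commute_descProd (r := j) (k := j + 1) (by omega) (by omega)
      have hb := hd.braid j (by omega)
      have hs : SemiconjBy (d (j + 1) * d j) (d (j + 1)) (d j) := by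
        rw [SemiconjBy, hb, mul_assoc]
      simpa only [descProd, mul_assoc] using hs.mul_left hc.symm

theorem semiconjBy_descProd_descProd (hd : IsBraidSeq d N) {r R : ℕ} (hr : r < R) (hR : R ≤ N) :
    SemiconjBy (descProd d R) (descProd (fun j => d (j + 1)) r) (descProd d r) := by
  induction r with
  | zero => exact SemiconjBy.one_right _
  | succ r ih => exact (hd.semiconjBy_descProd hr hR).mul_right (ih (by omega))

theorem descProd_mul_descProd_mul (hd : IsBraidSeq d N) {k : ℕ} (hk : k + 1 ≤ N) :
    descProd d k * descProd d (k + 1) * d 0 = descProd d (k + 1) * descProd d (k + 1) := by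
  rw [← (hd.semiconjBy_descProd_descProd (Nat.lt_succ_self k) hk).eq, mul_assoc,
    ← descProd_succ']

theorem semiconjBy_fundProd (hd : IsBraidSeq d N) {k m l : ℕ} (hk : k ≤ N) (hml : m + l + 1 = k) :
    SemiconjBy (fundProd d k) (d l) (d m) := by
  induction k generalizing m l with
  | zero => omega
  | succ k ih =>
    cases l with
    | succ l =>
      exact (ih (by omega) (by omega)).mul_left (hd.semiconjBy_descProd (by omega) hk)
    | zero =>
      obtain rfl : m = k := by omega
      cases m with
      | zero => simp [fundProd, descProd, SemiconjBy]
      | succ k =>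
        have hc := hd.commute_fundProd (r := k) (k := k + 1) (by omega) (by omega)
        have hp : descProd d (k + 2) = d (k + 1) * descProd d (k + 1) := rfl
        calc fundProd d k * descProd d (k + 1) * descProd d (k + 2) * d 0
            = fundProd d k * (descProd d (k + 1) * descProd d (k + 2) * d 0) := by
              simp only [mul_assoc]
          _ = fundProd d k * d (k + 1) * descProd d (k + 1) * descProd d (k + 2) := by
              rw [hd.descProd_mul_descProd_mul hk]
              nth_rewrite 1 [hp]
              simp only [mul_assoc]
          _ = d (k + 1) * (fundProd d k * descProd d (k + 1) * descProd d (k + 2)) := by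
              rw [← hc.eq]
              simp only [mul_assoc]

end IsBraidSeq

end Monoid

theorem a_eq_of_s13 (n : ℕ) (i : Fin n) : a n (i + 1) = PresentedMonoid.of (braidRels n) i := by
  have h : 1 ≤ (i : ℕ) + 1 ∧ (i : ℕ) + 1 ≤ n := by omega
  exact dif_pos h

theorem isBraidSeq_a (n : ℕ) : IsBraidSeq (fun j => a n (j + 2)) (n - 1) where
  braid j hj := by
    have h := PresentedMonoid.mk_eq_mk_of_rel (rels := braidRels n)
      (Or.inl ⟨⟨j + 1, by omega⟩, ⟨j + 2, by omega⟩, rfl, rfl, rfl⟩)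
    have h1 := a_eq_of_s13 n ⟨j + 1, by omega⟩
    have h2 := a_eq_of_s13 n ⟨j + 2, by omega⟩
    simp only at h1 h2 ⊢
    rw [h1, h2]
    exact h
  comm s k hs hk := by
    have h := PresentedMonoid.mk_eq_mk_of_rel (rels := braidRels n)
      (Or.inr ⟨⟨s + 1, by omega⟩, ⟨k + 1, by omega⟩, by simp only; omega, rfl, rfl⟩)
    have h1 := a_eq_of_s13 n ⟨s + 1, by omega⟩
    have h2 := a_eq_of_s13 n ⟨k + 1, by omega⟩
    simp only [Commute, SemiconjBy] at h1 h2 ⊢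
    rw [h1, h2]
    exact h

theorem prod_LamM_eq_fundProd (n k : ℕ) :
    ((List.range k).map fun m => LamM n (m + 2)).prod = fundProd (fun j => a n (j + 2)) k := by
  simp only [fundProd_eq_prod, descProd_eq_prod]
  rfl

end Braid

/-- For `2 ≤ i ≤ n` and a positive word `W` in the letters `a_1, …, a_{i−1}`,
in the positive braid monoid `B⁺_{n+1}` one has
`W' Λ_2^{(−)} Λ_3^{(−)} ⋯ Λ_i^{(−)} = Λ_2^{(−)} Λ_3^{(−)} ⋯ Λ_i^{(−)} W^{Δ_i}`. -/
theorem shifted_word_mul_LamM_prod (n i : ℕ) (hi1 : 2 ≤ i) (hi2 : i ≤ n) (W : List ℕ)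
    (hW : ∀ m ∈ W, 1 ≤ m ∧ m ≤ i - 1) :
    Braid.w n (W.map (· + 1)) * ((List.range (i - 1)).map (fun m => Braid.LamM n (m + 2))).prod
      = ((List.range (i - 1)).map (fun m => Braid.LamM n (m + 2))).prod
          * Braid.w n (W.map (fun m => i - m + 1)) := by
  rw [Braid.prod_LamM_eq_fundProd]
  induction W with
  | nil => simp [Braid.w]
  | cons m W ih =>
    obtain ⟨hm1, hm2⟩ := hW m List.mem_cons_self
    have ih := ih fun x hx => hW x (List.mem_cons_of_mem m hx)
    have h := (Braid.isBraidSeq_a n).semiconjBy_fundProd (k := i - 1) (m := m - 1)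
      (l := i - 1 - m) (by omega) (by omega)
    simp only [show m - 1 + 2 = m + 1 by omega, show i - 1 - m + 2 = i - m + 1 by omega] at h
    simp only [Braid.w, List.map_cons, List.prod_cons] at ih ⊢
    rw [mul_assoc, ih, ← mul_assoc, ← h.eq, mul_assoc]
end

section
/- The canonical monoid homomorphism ι : B⁺_{n+1} → B_{n+1}, sending each generator a_i of the positive braid monoid to the corresponding generator a_i of the braid group, is injective; that is, the semigroup of positive braids embeds into the braid group. -/
namespace BraidMonoid

variable {n : ℕ}

/-- The generator of the positive braid monoid indexed by `i`. -/
def gen (i : Fin n) : BraidMonoid n := PresentedMonoid.of (braidRels n) i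

/-- The quotient map from words to positive braids. -/
def ofWord : FreeMonoid (Fin n) →* BraidMonoid n := PresentedMonoid.mk (braidRels n)

theorem ofWord_of (i : Fin n) : ofWord (.of i) = gen i := rfl

theorem ofWord_surjective : Function.Surjective (ofWord (n := n)) :=
  PresentedMonoid.surjective_mk

theorem ofWord_eq_iff {u v : FreeMonoid (Fin n)} :
    ofWord u = ofWord v ↔ ConGen.Rel (braidRels n) u v :=
  PresentedMonoid.mk_eq_mk_iff

/-- Two generators of the braid monoid are adjacent if they satisfy the braid relation. -/
def Near (i j : Fin n) : Prop := (i : ℕ) + 1 = j ∨ (j : ℕ) + 1 = i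

/-- Two generators of the braid monoid are distant if they satisfy the commutation relation. -/
def Far (i j : Fin n) : Prop := (i : ℕ) + 2 ≤ j ∨ (j : ℕ) + 2 ≤ i

theorem Near.symm {i j : Fin n} (h : Near i j) : Near j i := Or.symm h

theorem Far.symm {i j : Fin n} (h : Far i j) : Far j i := Or.symm h

theorem Far.gen_mul {i j : Fin n} (h : Far i j) : gen i * gen j = gen j * gen i := by
  rcases h with h | h
  · exact (PresentedMonoid.mk_eq_mk_of_rel (Or.inr ⟨i, j, h, rfl, rfl⟩)).symm
  · exact PresentedMonoid.mk_eq_mk_of_rel (Or.inr ⟨j, i, h, rfl, rfl⟩)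

theorem Near.gen_mul {i j : Fin n} (h : Near i j) :
    gen i * gen j * gen i = gen j * gen i * gen j := by
  rcases h with h | h
  · exact (PresentedMonoid.mk_eq_mk_of_rel (Or.inl ⟨i, j, h, rfl, rfl⟩)).symm
  · exact PresentedMonoid.mk_eq_mk_of_rel (Or.inl ⟨j, i, h, rfl, rfl⟩)

theorem Far.gen_mul_left {i j : Fin n} (h : Far i j) (x : BraidMonoid n) :
    gen i * (gen j * x) = gen j * (gen i * x) := by
  simp only [← mul_assoc, h.gen_mul]

theorem Near.gen_mul_left {i j : Fin n} (h : Near i j) (x : BraidMonoid n) :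
    gen i * (gen j * (gen i * x)) = gen j * (gen i * (gen j * x)) := by
  simp only [← mul_assoc, h.gen_mul]

/-- The length homomorphism on positive braids. -/
def lengthHom : BraidMonoid n →* Multiplicative ℕ :=
  PresentedMonoid.lift (rels := braidRels n) (fun _ => Multiplicative.ofAdd 1) (by
    rintro x y (⟨i, j, -, rfl, rfl⟩ | ⟨i, j, -, rfl, rfl⟩) <;> rfl)

/-- The length of a positive braid. -/
def length (x : BraidMonoid n) : ℕ := (lengthHom x).toAdd

theorem length_mul (x y : BraidMonoid n) : length (x * y) = length x + length y := by
  simp [length]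

theorem length_gen (i : Fin n) : length (gen i) = 1 := rfl

theorem length_gen_mul (i : Fin n) (x : BraidMonoid n) : length (gen i * x) = length x + 1 := by
  rw [length_mul, length_gen, add_comm]

theorem length_ofWord (u : FreeMonoid (Fin n)) : length (ofWord u) = u.length := by
  induction u using FreeMonoid.inductionOn' with
  | one => simp [length]
  | of_mul i u ih =>
    rw [map_mul, ofWord_of, length_gen_mul, ih, FreeMonoid.length_mul, FreeMonoid.length_of,
      add_comm]

/-- The expected shape of the cofactors `x`, `y` in an equality `gen i * x = gen j * y`: both sides
are a multiple of the least common multiple of the two generators. -/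
def Compat (i j : Fin n) (x y : BraidMonoid n) : Prop :=
  (i = j ∧ x = y) ∨
  (Far i j ∧ ∃ u, x = gen j * u ∧ y = gen i * u) ∨
  (Near i j ∧ ∃ u, x = gen j * (gen i * u) ∧ y = gen i * (gen j * u))

theorem Compat.symm {i j : Fin n} {x y : BraidMonoid n} (h : Compat i j x y) :
    Compat j i y x := by
  rcases h with ⟨h, h'⟩ | ⟨h, u, h₁, h₂⟩ | ⟨h, u, h₁, h₂⟩
  · exact Or.inl ⟨h.symm, h'.symm⟩
  · exact Or.inr (Or.inl ⟨h.symm, u, h₂, h₁⟩)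
  · exact Or.inr (Or.inr ⟨h.symm, u, h₂, h₁⟩)

theorem Compat.mul_right {i j : Fin n} {x y : BraidMonoid n} (h : Compat i j x y)
    (z : BraidMonoid n) : Compat i j (x * z) (y * z) := by
  rcases h with ⟨h, rfl⟩ | ⟨h, u, rfl, rfl⟩ | ⟨h, u, rfl, rfl⟩
  · exact Or.inl ⟨h, rfl⟩
  · exact Or.inr (Or.inl ⟨h, u * z, by simp only [mul_assoc], by simp only [mul_assoc]⟩)
  · exact Or.inr (Or.inr ⟨h, u * z, by simp only [mul_assoc], by simp only [mul_assoc]⟩)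

theorem eq_or_far_or_near (i j : Fin n) : i = j ∨ Far i j ∨ Near i j := by
  unfold Far Near
  omega

theorem not_near_self {i : Fin n} : ¬ Near i i := by
  unfold Near
  omega

theorem not_far_self {i : Fin n} : ¬ Far i i := by
  unfold Far
  omega

theorem Near.not_far {i j : Fin n} (h : Near i j) : ¬ Far i j := by
  unfold Far Near at *
  omega

theorem Near.not_near_of_near {i j k : Fin n} (h : Near i k) (h' : Near k j) : ¬ Near i j := by
  unfold Near at *
  omega

/-- Equalities `gen i * x = gen j * y` with `x` of length less than `l` have the expected shape. -/
def CompatBelow (n l : ℕ) : Prop :=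
  ∀ (i j : Fin n) (x y : BraidMonoid n), length x < l → gen i * x = gen j * y → Compat i j x y

namespace CompatBelow

variable {l : ℕ} {i j : Fin n} {x y : BraidMonoid n}

theorem cancel (H : CompatBelow n l) (hx : length x < l) (h : gen i * x = gen i * y) :
    x = y := by
  rcases H i i x y hx h with ⟨-, h⟩ | ⟨h, -⟩ | ⟨h, -⟩
  · exact h
  · exact absurd h not_far_self
  · exact absurd h not_near_self

theorem far (H : CompatBelow n l) (hij : Far i j) (hx : length x < l)
    (h : gen i * x = gen j * y) : ∃ u, x = gen j * u ∧ y = gen i * u := by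
  rcases H i j x y hx h with ⟨rfl, -⟩ | ⟨-, h⟩ | ⟨h, -⟩
  · exact absurd hij not_far_self
  · exact h
  · exact absurd hij h.not_far

theorem near (H : CompatBelow n l) (hij : Near i j) (hx : length x < l)
    (h : gen i * x = gen j * y) : ∃ u, x = gen j * (gen i * u) ∧ y = gen i * (gen j * u) := by
  rcases H i j x y hx h with ⟨rfl, -⟩ | ⟨h, -⟩ | ⟨-, h⟩
  · exact absurd hij not_near_self
  · exact absurd h hij.not_far
  · exact h

end CompatBelow

theorem Compat.trans_far_far {i j k : Fin n} (hik : Far i k) (hkj : Far k j)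
    {u v : BraidMonoid n} (H : CompatBelow n (length (gen i * u)))
    (h : gen i * u = gen j * v) : Compat i j (gen k * u) (gen k * v) := by
  rw [length_gen_mul] at H
  rcases H i j u v (by omega) h with ⟨hij, huv⟩ | ⟨hij, w, rfl, rfl⟩ | ⟨hij, w, rfl, rfl⟩
  · exact Or.inl ⟨hij, by rw [huv]⟩
  · exact Or.inr (Or.inl ⟨hij, gen k * w, hkj.gen_mul_left _, hik.symm.gen_mul_left _⟩)
  · refine Or.inr (Or.inr ⟨hij, gen k * w, ?_, ?_⟩)
    · rw [hkj.gen_mul_left, hik.symm.gen_mul_left]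
    · rw [hik.symm.gen_mul_left, hkj.gen_mul_left]

theorem Compat.trans_near_far {i j k : Fin n} (hik : Near i k) (hkj : Far k j)
    {u v : BraidMonoid n} (H : CompatBelow n (length (gen i * (gen k * u))))
    (h : gen i * (gen k * u) = gen j * v) : Compat i j (gen k * (gen i * u)) (gen k * v) := by
  simp only [length_gen_mul] at H
  rcases eq_or_far_or_near i j with rfl | hij | hij
  · exact absurd hkj hik.symm.not_far
  · obtain ⟨w, hw, rfl⟩ := H.far hij (by simp only [length_gen_mul]; omega) h
    obtain ⟨t, rfl, rfl⟩ := H.far hkj (by omega) hw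
    refine Or.inr (Or.inl ⟨hij, gen k * (gen i * t), ?_, ?_⟩)
    · rw [hij.gen_mul_left, hkj.gen_mul_left]
    · rw [hik.gen_mul_left]
  · obtain ⟨w, hw, rfl⟩ := H.near hij (by simp only [length_gen_mul]; omega) h
    have hlen := congrArg length hw
    simp only [length_gen_mul] at hlen
    obtain ⟨t, rfl, ht⟩ := H.far hkj (by omega) hw
    simp only [length_gen_mul] at hlen H
    obtain ⟨s, rfl, rfl⟩ := H.near hik (by omega) ht
    refine Or.inr (Or.inr ⟨hij, gen k * (gen i * (gen j * s)), ?_, ?_⟩)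
    · rw [hij.gen_mul_left, hkj.gen_mul_left, hkj.symm.gen_mul_left s, hik.symm.gen_mul_left]
    · rw [hkj.symm.gen_mul_left, hik.symm.gen_mul_left, hij.gen_mul_left, hkj.gen_mul_left]

theorem Compat.trans_near_near {i j k : Fin n} (hik : Near i k) (hkj : Near k j)
    {u v : BraidMonoid n} (H : CompatBelow n (length (gen i * (gen k * u))))
    (h : gen i * (gen k * u) = gen j * (gen k * v)) :
    Compat i j (gen k * (gen i * u)) (gen k * (gen j * v)) := by
  simp only [length_gen_mul] at H
  have hlen := congrArg length h
  simp only [length_gen_mul] at hlen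
  rcases eq_or_far_or_near i j with rfl | hij | hij
  · have huv := H.cancel (by omega) (H.cancel (by simp only [length_gen_mul]; omega) h)
    exact Or.inl ⟨rfl, by rw [huv]⟩
  · obtain ⟨w, hu, hv⟩ := H.far hij (by simp only [length_gen_mul]; omega) h
    have hlenu := congrArg length hu
    simp only [length_gen_mul] at hlenu
    obtain ⟨t, rfl, rfl⟩ := H.near hkj (by omega) hu
    obtain ⟨s, rfl, hs⟩ := H.near hik.symm (by omega) hv
    simp only [length_gen_mul] at hlenu H
    have hts := H.cancel (by simp only [length_gen_mul]; omega) hs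
    obtain ⟨r, rfl, rfl⟩ := H.far hij.symm (by omega) hts
    refine Or.inr (Or.inl ⟨hij, gen k * (gen j * (gen i * (gen k * r))), ?_, ?_⟩)
    · rw [hij.gen_mul_left, hik.gen_mul_left, hkj.gen_mul_left]
    · rw [hij.symm.gen_mul_left, hkj.symm.gen_mul_left, hik.symm.gen_mul_left, hij.gen_mul_left]
  · exact absurd hij (hik.not_near_of_near hkj)

theorem Compat.trans {i j k : Fin n} {x y z : BraidMonoid n} (H : CompatBelow n (length z))
    (hxz : Compat i k x z) (hzy : Compat k j z y) : Compat i j x y := by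
  rcases hxz with ⟨rfl, rfl⟩ | ⟨hik, u, rfl, rfl⟩ | ⟨hik, u, rfl, rfl⟩
  · exact hzy
  · rcases hzy with ⟨rfl, rfl⟩ | ⟨hkj, v, h, rfl⟩ | ⟨hkj, v, h, rfl⟩
    · exact Or.inr (Or.inl ⟨hik, u, rfl, rfl⟩)
    · exact trans_far_far hik hkj H h
    · exact (trans_near_far hkj.symm hik.symm (h ▸ H) h.symm).symm
  · rcases hzy with ⟨rfl, rfl⟩ | ⟨hkj, v, h, rfl⟩ | ⟨hkj, v, h, rfl⟩
    · exact Or.inr (Or.inr ⟨hik, u, rfl, rfl⟩)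
    · exact trans_near_far hik hkj H h
    · exact trans_near_near hik hkj H h

theorem compat_of_rel {l : ℕ} (H : CompatBelow n l) {u v : FreeMonoid (Fin n)}
    (huv : ConGen.Rel (braidRels n) u v) (i j : Fin n) (x y : FreeMonoid (Fin n))
    (hl : x.length ≤ l) (hu : u = .of i * x) (hv : v = .of j * y) :
    Compat i j (ofWord x) (ofWord y) := by
  induction huv generalizing i j x y with
  | of u v h =>
    rcases h with ⟨p, q, hpq, rfl, rfl⟩ | ⟨p, q, hpq, rfl, rfl⟩
    · rw [mul_assoc] at hu hv
      obtain ⟨rfl, rfl⟩ := List.cons.inj hu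
      obtain ⟨rfl, rfl⟩ := List.cons.inj hv
      exact Or.inr (Or.inr ⟨Or.inr hpq, 1, rfl, rfl⟩)
    · obtain ⟨rfl, rfl⟩ := List.cons.inj hu
      obtain ⟨rfl, rfl⟩ := List.cons.inj hv
      exact Or.inr (Or.inl ⟨Or.inr hpq, 1, rfl, rfl⟩)
  | refl u =>
    obtain ⟨rfl, rfl⟩ := List.cons.inj (hu.symm.trans hv)
    exact Or.inl ⟨rfl, rfl⟩
  | @symm u v h ih =>
    have hlen := congrArg length (ofWord_eq_iff.2 h)
    simp only [length_ofWord, hu, hv, FreeMonoid.length_mul, FreeMonoid.length_of] at hlen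
    exact (ih j i y x (by omega) hv hu).symm
  | @trans u w v h₁ h₂ ih₁ ih₂ =>
    have hlen := congrArg length (ofWord_eq_iff.2 h₁)
    cases w using FreeMonoid.casesOn with
    | one => simp only [length_ofWord, hu, FreeMonoid.length_mul, FreeMonoid.length_of,
        FreeMonoid.length_one, Nat.add_eq_zero_iff, one_ne_zero, false_and] at hlen
    | of_mul k z =>
      simp only [length_ofWord, hu, FreeMonoid.length_mul, FreeMonoid.length_of] at hlen
      refine Compat.trans (fun p q x y hx => H p q x y ?_) (ih₁ i k x z hl hu rfl)
        (ih₂ k j z y (by omega) rfl hv)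
      rw [length_ofWord] at hx
      omega
  | @mul u₁ v₁ u₂ v₂ h₁ h₂ ih₁ ih₂ =>
    have hlen := congrArg length (ofWord_eq_iff.2 h₁)
    simp only [length_ofWord] at hlen
    cases u₁ using FreeMonoid.casesOn with
    | one =>
      obtain rfl : v₁ = 1 := FreeMonoid.length_eq_zero.1 hlen.symm
      exact ih₂ i j x y hl (by simpa using hu) (by simpa using hv)
    | of_mul p x₁ =>
      cases v₁ using FreeMonoid.casesOn with
      | one => simp at hlen
      | of_mul q y₁ =>
        rw [mul_assoc] at hu hv
        obtain ⟨rfl, rfl⟩ := List.cons.inj hu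
        obtain ⟨rfl, rfl⟩ := List.cons.inj hv
        have hl' : x₁.length + u₂.length ≤ l := by
          rw [← FreeMonoid.length_mul]
          exact hl
        have key := (ih₁ p q x₁ y₁ (by omega) rfl rfl).mul_right (ofWord u₂)
        have he := ofWord_eq_iff.2 h₂
        change Compat p q (ofWord (x₁ * u₂)) (ofWord (y₁ * v₂))
        rw [map_mul, map_mul, ← he]
        exact key

theorem compatBelow (n l : ℕ) : CompatBelow n l := by
  induction l with
  | zero => exact fun _ _ _ _ h => absurd h (Nat.not_lt_zero _)
  | succ l ih =>
    intro i j x y hx h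
    obtain ⟨x, rfl⟩ := ofWord_surjective x
    obtain ⟨y, rfl⟩ := ofWord_surjective y
    rw [length_ofWord] at hx
    refine compat_of_rel ih (ofWord_eq_iff.1 ?_) i j x y (by omega) rfl rfl
    simpa only [map_mul, ofWord_of] using h

@[elab_as_elim]
theorem gen_induction {p : BraidMonoid n → Prop} (one : p 1)
    (gen_mul : ∀ i x, p x → p (gen i * x)) (x : BraidMonoid n) : p x := by
  obtain ⟨u, rfl⟩ := ofWord_surjective x
  induction u using FreeMonoid.inductionOn' with
  | one => simpa using one
  | of_mul i u ih => simpa only [map_mul, ofWord_of] using gen_mul i _ ih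

theorem gen_mul_left_cancel {i : Fin n} {x y : BraidMonoid n} (h : gen i * x = gen i * y) :
    x = y :=
  (compatBelow n (length x + 1)).cancel (Nat.lt_succ_self _) h

/-- The positive braid monoid is left cancellative. -/
theorem mul_left_cancel' (z : BraidMonoid n) {x y : BraidMonoid n} (h : z * x = z * y) :
    x = y := by
  induction z using gen_induction with
  | one => simpa using h
  | gen_mul i z ih => exact ih (gen_mul_left_cancel (by simpa only [mul_assoc] using h))

section Coxeter

open Braid

theorem a_succ {i : ℕ} (hi : i < n) : a n (i + 1) = gen ⟨i, hi⟩ := by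
  exact dif_pos (by omega : 1 ≤ i + 1 ∧ i + 1 ≤ n)

theorem a_comm {i j : ℕ} (hij : i + 2 ≤ j) (hj : j < n) :
    a n (j + 1) * a n (i + 1) = a n (i + 1) * a n (j + 1) := by
  rw [a_succ hj, a_succ (by omega)]
  exact Far.gen_mul (Or.inr hij)

theorem a_braid {i : ℕ} (hi : i + 1 < n) :
    a n (i + 1) * a n (i + 2) * a n (i + 1) = a n (i + 2) * a n (i + 1) * a n (i + 2) := by
  rw [a_succ hi, a_succ (by omega)]
  exact Near.gen_mul (Or.inl rfl)

/-- The ascending product `a_1 a_2 ⋯ a_m`. -/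
def cox (n m : ℕ) : BraidMonoid n := ((List.range m).map (fun k => a n (k + 1))).prod

theorem cox_zero : cox n 0 = 1 := rfl

theorem cox_succ (m : ℕ) : cox n (m + 1) = cox n m * a n (m + 1) := by
  simp [cox, List.range_succ]

theorem a_mul_cox {m j : ℕ} (hj : m + 1 ≤ j) (hjn : j < n) :
    a n (j + 1) * cox n m = cox n m * a n (j + 1) := by
  induction m with
  | zero => simp [cox_zero]
  | succ m ih =>
    rw [cox_succ, ← mul_assoc, ih (by omega), mul_assoc, a_comm hj hjn, mul_assoc]

theorem cox_mul_a {m i : ℕ} (hi : i + 2 ≤ m) (hm : m ≤ n) :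
    cox n m * a n (i + 1) = a n (i + 2) * cox n m := by
  induction m, hi using Nat.le_induction with
  | base =>
    rw [cox_succ, cox_succ, mul_assoc (cox n i), mul_assoc (cox n i), a_braid (by omega),
      ← mul_assoc, ← mul_assoc, ← mul_assoc, ← mul_assoc, a_mul_cox le_rfl (by omega)]
  | succ m hm' ih =>
    rw [cox_succ, mul_assoc, a_comm hm' (by omega), ← mul_assoc, ih (by omega), mul_assoc]

/-- `a_1` times the shift by one of `a_1 ⋯ a_m`, obtained through conjugation by `cox n n`. -/
theorem exists_cox_succ {m : ℕ} (hm : m + 1 ≤ n) :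
    ∃ s, cox n (m + 1) = a n 1 * s ∧ cox n n * cox n m = s * cox n n := by
  induction m with
  | zero => exact ⟨1, by simp [cox_succ, cox_zero], by simp [cox_zero]⟩
  | succ m ih =>
    obtain ⟨s, h₁, h₂⟩ := ih (by omega)
    refine ⟨s * a n (m + 2), by rw [cox_succ, h₁, mul_assoc], ?_⟩
    rw [cox_succ, ← mul_assoc, h₂, mul_assoc, cox_mul_a (by omega) le_rfl, mul_assoc]

theorem cox_sq_mul_a : cox (n + 1) (n + 1) ^ 2 * a (n + 1) (n + 1) =
    a (n + 1) 1 * cox (n + 1) (n + 1) ^ 2 := by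
  obtain ⟨s, h₁, h₂⟩ := exists_cox_succ (n := n + 1) (m := n) le_rfl
  set c := cox (n + 1) (n + 1)
  have h₃ : c = cox (n + 1) n * a (n + 1) (n + 1) := cox_succ n
  rw [sq]
  nth_rw 1 [h₁]
  rw [mul_assoc, mul_assoc, ← mul_assoc s, ← h₂, mul_assoc c, ← h₃]

theorem cox_pow_mul_a {m i : ℕ} (h : i + m < n) :
    cox n n ^ m * a n (i + 1) = a n (i + m + 1) * cox n n ^ m := by
  induction m with
  | zero => simp
  | succ m ih =>
    rw [pow_succ', mul_assoc, ih (by omega), ← mul_assoc, cox_mul_a (by omega) le_rfl, mul_assoc]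
    rfl

/-- The element `(a_1 a_2 ⋯ a_n) ^ (n + 1)`, the square of the Garside element. -/
def fullTwist (n : ℕ) : BraidMonoid n := cox n n ^ (n + 1)

theorem exists_fullTwist_eq_a_mul {i : ℕ} (hi : i < n) :
    ∃ s, fullTwist n = a n (i + 1) * s := by
  obtain ⟨m, rfl⟩ := Nat.exists_eq_add_of_lt hi
  obtain ⟨s, hs, -⟩ := exists_cox_succ (n := i + m + 1) (m := i + m) le_rfl
  refine ⟨cox (i + m + 1) (i + m + 1) ^ i * (s * cox (i + m + 1) (i + m + 1) ^ (m + 1)), ?_⟩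
  have h := cox_pow_mul_a (n := i + m + 1) (i := 0) (m := i) (by omega)
  rw [zero_add, zero_add] at h
  rw [fullTwist, ← mul_assoc, ← h, mul_assoc, ← mul_assoc (a _ 1), ← hs, ← pow_succ', ← pow_add]
  congr 1

theorem fullTwist_mul_a {i : ℕ} (hi : i < n) :
    fullTwist n * a n (i + 1) = a n (i + 1) * fullTwist n := by
  obtain ⟨m, rfl⟩ := Nat.exists_eq_add_of_lt hi
  have h₁ := cox_pow_mul_a (n := i + m + 1) (i := i) (m := m) (by omega)
  have h₂ := cox_pow_mul_a (n := i + m + 1) (i := 0) (m := i) (by omega)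
  rw [zero_add, zero_add] at h₂
  have h₃ := cox_sq_mul_a (n := i + m)
  have h₄ : fullTwist (i + m + 1) = cox (i + m + 1) (i + m + 1) ^ i *
      (cox (i + m + 1) (i + m + 1) ^ 2 * cox (i + m + 1) (i + m + 1) ^ m) := by
    rw [fullTwist, ← pow_add, ← pow_add]
    congr 1
    omega
  rw [h₄, mul_assoc, mul_assoc, h₁, ← mul_assoc (_ ^ 2), h₃, mul_assoc, ← mul_assoc, h₂, mul_assoc]

end Coxeter

theorem fullTwist_mul_gen (i : Fin n) : fullTwist n * gen i = gen i * fullTwist n := by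
  rw [← a_succ i.2]
  exact fullTwist_mul_a i.2

theorem fullTwist_comm (x : BraidMonoid n) : Commute (fullTwist n) x := by
  induction x using gen_induction with
  | one => exact Commute.one_right _
  | gen_mul i x ih => exact Commute.mul_right (fullTwist_mul_gen i) ih

theorem exists_mul_gen_eq_fullTwist (i : Fin n) : ∃ s, s * gen i = fullTwist n := by
  obtain ⟨s, hs⟩ : ∃ s, fullTwist n = gen i * s := by
    rw [← a_succ i.2]
    exact exists_fullTwist_eq_a_mul i.2
  refine ⟨s, gen_mul_left_cancel (i := i) ?_⟩
  rw [← mul_assoc, ← hs, fullTwist_mul_gen]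

theorem exists_mul_eq_fullTwist_pow (x : BraidMonoid n) : ∃ s k, s * x = fullTwist n ^ k := by
  induction x using gen_induction with
  | one => exact ⟨1, 0, by simp⟩
  | gen_mul i x ih =>
    obtain ⟨s, k, hs⟩ := ih
    obtain ⟨t, ht⟩ := exists_mul_gen_eq_fullTwist i
    refine ⟨s * t, k + 1, ?_⟩
    rw [mul_assoc, ← mul_assoc t, ht, (fullTwist_comm x).eq, ← mul_assoc, hs, pow_succ]

theorem exists_common_left_multiple (x y : BraidMonoid n) : ∃ u v, u * x = v * y := by
  obtain ⟨s, k, hs⟩ := exists_mul_eq_fullTwist_pow y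
  refine ⟨fullTwist n ^ k, x * s, ?_⟩
  rw [mul_assoc, hs, ((fullTwist_comm x).pow_left k).eq]

/-- The positive braid monoid is right cancellative. -/
theorem mul_right_cancel' {x y z : BraidMonoid n} (h : x * z = y * z) : x = y := by
  obtain ⟨s, k, hs⟩ := exists_mul_eq_fullTwist_pow z
  have hz : z * s = fullTwist n ^ k := by
    refine mul_left_cancel' s ?_
    rw [← mul_assoc, hs, ((fullTwist_comm s).pow_left k).eq]
  refine mul_left_cancel' (fullTwist n ^ k) ?_
  rw [((fullTwist_comm x).pow_left k).eq, ((fullTwist_comm y).pow_left k).eq, ← hz, ← mul_assoc, h,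
    mul_assoc]

/-- Positive braids satisfy the Ore condition. -/
noncomputable instance oreSetTop : OreLocalization.OreSet (⊤ : Submonoid (BraidMonoid n)) where
  ore_right_cancel _ _ _ h := ⟨1, by rw [mul_right_cancel' h]⟩
  oreNum x y := (exists_common_left_multiple x y).choose_spec.choose
  oreDenom x y := ⟨(exists_common_left_multiple x y).choose, trivial⟩
  ore_eq x y := (exists_common_left_multiple x y).choose_spec.choose_spec

/-- The map to the monoid of left fractions. -/
noncomputable abbrev toFrac : BraidMonoid n →*
    OreLocalization (⊤ : Submonoid (BraidMonoid n)) (BraidMonoid n) :=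
  OreLocalization.numeratorHom

theorem toFrac_injective : Function.Injective (toFrac (n := n)) := by
  intro x y h
  obtain ⟨u, v, h₁, h₂⟩ := OreLocalization.oreDiv_eq_iff.1 h
  have huv : (u : BraidMonoid n) = v := by simpa using h₂
  refine mul_left_cancel' v (Eq.symm ?_)
  rw [← huv] at h₁ ⊢
  exact h₁

/-- Positive braids as units of the monoid of left fractions. -/
noncomputable def toFracUnit : BraidMonoid n →*
    (OreLocalization (⊤ : Submonoid (BraidMonoid n)) (BraidMonoid n))ˣ :=
  IsUnit.liftRight toFrac fun x =>
    OreLocalization.numerator_isUnit (⟨x, trivial⟩ : (⊤ : Submonoid (BraidMonoid n)))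

theorem coe_toFracUnit (x : BraidMonoid n) : (toFracUnit x : OreLocalization _ _) = toFrac x :=
  IsUnit.coe_liftRight _ _ _

theorem toFracUnit_injective : Function.Injective (toFracUnit (n := n)) := fun x y h =>
  toFrac_injective (by rw [← coe_toFracUnit, h, coe_toFracUnit])

/-- The homomorphism from the braid group to the group of fractions of the braid monoid. -/
noncomputable def fracHom (n : ℕ) : BraidGroup n →*
    (OreLocalization (⊤ : Submonoid (BraidMonoid n)) (BraidMonoid n))ˣ :=
  PresentedGroup.toGroup (rels := braidRelators n) (f := fun i => toFracUnit (gen i)) (by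
    rintro r (⟨i, j, hij, rfl⟩ | ⟨i, j, hij, rfl⟩)
    · simp only [map_mul, map_inv, FreeGroup.lift_apply_of, mul_inv_eq_one]
      simp only [← map_mul, Near.gen_mul (Or.inl hij)]
    · simp only [map_mul, map_inv, FreeGroup.lift_apply_of, mul_inv_eq_one]
      simp only [← map_mul, Far.gen_mul (Or.inl hij)])

theorem fracHom_of (i : Fin n) :
    fracHom n (PresentedGroup.of (rels := braidRelators n) i) = toFracUnit (gen i) :=
  PresentedGroup.toGroup.of _

end BraidMonoid

/-- The canonical monoid homomorphism `ι : B⁺_{n+1} → B_{n+1}`, sending each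
generator `a_i` of the positive braid monoid to the corresponding generator `a_i` of the braid
group, is injective: the semigroup of positive braids embeds into the braid group. -/
theorem positive_braid_monoid_embeds (n : ℕ) (hn : 1 ≤ n)
    (ι : BraidMonoid n →* BraidGroup n)
    (hι : ∀ j : Fin n, ι (PresentedMonoid.of (braidRels n) j)
        = PresentedGroup.of (rels := braidRelators n) j) :
    Function.Injective ι := by
  have h : (BraidMonoid.fracHom n).comp ι = BraidMonoid.toFracUnit := by
    refine PresentedMonoid.ext (braidRels n) fun i => ?_
    exact (congrArg (BraidMonoid.fracHom n) (hι i)).trans (BraidMonoid.fracHom_of i)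
  refine Function.Injective.of_comp (f := BraidMonoid.fracHom n) ?_
  rw [← MonoidHom.coe_comp, h]
  exact BraidMonoid.toFracUnit_injective
end
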